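/- Let 𝔤 = 𝒜₄,₄ be the 4-dimensional real Lie algebra with brackets [e₁,e₄] = e₁, [e₂,e₄] = e₁ + e₂, [e₃,e₄] = e₂ + e₃. Then for every inner product g on 𝔤 and every alternating 2-form F on 𝔤 such that (g,F) is a solution of the Einstein–Maxwell equations, the metric g is Einstein. -/

import Mathlib

open scoped BigOperators

noncomputable section

/-- The underlying vector space `ℝ⁴` of the 4-dimensional Lie algebra. -/
abbrev V4 : Type := Fin 4 → ℝ

/-- The standard basis `e₁, e₂, e₃, e₄` (0-indexed). -/
def ee (i : Fin 4) : V4 := Pi.single i 1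

/-- `g` is an inner product: a positive-definite symmetric bilinear form. -/
structure IsInnerProduct (g : V4 → V4 → ℝ) : Prop where
  symm : ∀ x y, g x y = g y x
  add_left : ∀ x y z, g (x + y) z = g x z + g y z
  smul_left : ∀ (a : ℝ) (x y : V4), g (a • x) y = a * g x y
  pos : ∀ x : V4, x ≠ 0 → 0 < g x x

/-- `F` is an alternating bilinear 2-form. -/
structure IsAltForm (F : V4 → V4 → ℝ) : Prop where
  skew : ∀ x y, F x y = - F y x
  add_left : ∀ x y z, F (x + y) z = F x z + F y z
  smul_left : ∀ (a : ℝ) (x y : V4), F (a • x) y = a * F x y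

/-- Chevalley–Eilenberg differential of a 2-form with respect to the bracket `br`:
`dF(x,y,z) = −F([x,y],z) + F([x,z],y) − F([y,z],x)`. -/
def cdiff (br : V4 → V4 → V4) (F : V4 → V4 → ℝ) (x y z : V4) : ℝ :=
  - F (br x y) z + F (br x z) y - F (br y z) x

/-- A 2-form is closed if its Chevalley–Eilenberg differential vanishes. -/
def IsClosedForm (br : V4 → V4 → V4) (F : V4 → V4 → ℝ) : Prop :=
  ∀ x y z, cdiff br F x y z = 0

/-- The Gram matrix of a bilinear form in the standard basis. -/
def gram (g : V4 → V4 → ℝ) : Matrix (Fin 4) (Fin 4) ℝ :=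
  Matrix.of fun i j => g (ee i) (ee j)

/-- The inverse Gram matrix. -/
def ginv (g : V4 → V4 → ℝ) : Matrix (Fin 4) (Fin 4) ℝ := (gram g)⁻¹

/-- The inner product induced by `g` on 2-forms:
`⟨α,β⟩ = (1/2) Σ g^{ik} g^{jl} α_{ij} β_{kl}`. -/
def formInner (g : V4 → V4 → ℝ) (α β : V4 → V4 → ℝ) : ℝ :=
  (1 / 2) * ∑ i, ∑ j, ∑ k, ∑ l,
    ginv g i k * ginv g j l * α (ee i) (ee j) * β (ee k) (ee l)

/-- The volume form of `g` for the orientation `e¹∧e²∧e³∧e⁴`. -/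
def vol (g : V4 → V4 → ℝ) (x y z w : V4) : ℝ :=
  Real.sqrt (gram g).det * Matrix.det (Matrix.of fun i j => ![x, y, z, w] i j)

/-- The wedge product of two 2-forms, as a 4-form. -/
def wedge22 (α β : V4 → V4 → ℝ) (x y z w : V4) : ℝ :=
  α x y * β z w - α x z * β y w + α x w * β y z
    + α z w * β x y - α y w * β x z + α y z * β x w

/-- `sF` is the Hodge star `⋆F` of `F` with respect to `g` and the orientation
`e¹∧e²∧e³∧e⁴`: it is the 2-form with `α ∧ sF = ⟨α,F⟩_g vol_g` for all 2-forms `α`. -/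
def IsHodgeStar (g : V4 → V4 → ℝ) (F sF : V4 → V4 → ℝ) : Prop :=
  IsAltForm sF ∧
    ∀ α : V4 → V4 → ℝ, IsAltForm α → ∀ x y z w,
      wedge22 α sF x y z w = formInner g α F * vol g x y z w

/-- `F` is co-closed: `d(⋆F) = 0`. -/
def IsCoclosed (br : V4 → V4 → V4) (g F : V4 → V4 → ℝ) : Prop :=
  ∃ sF, IsHodgeStar g F sF ∧ IsClosedForm br sF

/-- Koszul expression: `g(∇ₓy, z) = (1/2)(g([x,y],z) − g([y,z],x) + g([z,x],y))`. -/
def koszul (br : V4 → V4 → V4) (g : V4 → V4 → ℝ) (x y z : V4) : ℝ :=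
  (1 / 2) * (g (br x y) z - g (br y z) x + g (br z x) y)

/-- The Levi-Civita product `∇ₓ y`, i.e. the unique vector with
`g(∇ₓy, z) = koszul x y z` for all `z` (computed via the inverse Gram matrix). -/
def LC (br : V4 → V4 → V4) (g : V4 → V4 → ℝ) (x y : V4) : V4 :=
  fun m => ∑ k, koszul br g x y (ee k) * ginv g k m

/-- Curvature `R(x,y)z = ∇ₓ∇_y z − ∇_y∇ₓ z − ∇_{[x,y]} z`. -/
def curv (br : V4 → V4 → V4) (g : V4 → V4 → ℝ) (x y z : V4) : V4 :=
  LC br g x (LC br g y z) - LC br g y (LC br g x z) - LC br g (br x y) z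

/-- Ricci tensor `Ric(x,y) = Σᵢ g(R(vᵢ,x)y, vᵢ)` for a `g`-orthonormal basis `(vᵢ)`,
i.e. the trace of the endomorphism `z ↦ R(z,x)y`. -/
def ricci (br : V4 → V4 → V4) (g : V4 → V4 → ℝ) (x y : V4) : ℝ :=
  ∑ i, curv br g (ee i) x y i

/-- Scalar curvature: the `g`-trace of the Ricci tensor. -/
def scal (br : V4 → V4 → V4) (g : V4 → V4 → ℝ) : ℝ :=
  ∑ a, ∑ b, ginv g a b * ricci br g (ee a) (ee b)

/-- Trace-free Ricci tensor `Ric₀ = Ric − (s/4) g`. -/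
def ricci0 (br : V4 → V4 → V4) (g : V4 → V4 → ℝ) (x y : V4) : ℝ :=
  ricci br g x y - (scal br g / 4) * g x y

/-- `g` is Einstein: `Ric₀ = 0`. -/
def IsEinstein (br : V4 → V4 → V4) (g : V4 → V4 → ℝ) : Prop :=
  ∀ x y, ricci0 br g x y = 0

/-- The endomorphism `F̂` with `g(F̂x, y) = F(x,y)` (computed via the inverse Gram matrix). -/
def fhat (g F : V4 → V4 → ℝ) (x : V4) : V4 :=
  fun m => ∑ k, F x (ee k) * ginv g k m

/-- `[F∘F]₀(x,y) = g(F̂(F̂x), y) − (1/4) tr(F̂∘F̂) g(x,y)`. -/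
def FF0 (g F : V4 → V4 → ℝ) (x y : V4) : ℝ :=
  g (fhat g F (fhat g F x)) y
    - (1 / 4) * (∑ i, fhat g F (fhat g F (ee i)) i) * g x y

/-- `(g, F)` is a solution of the Einstein--Maxwell equations:
`dF = 0`, `d(⋆F) = 0`, and `Ric₀ = −[F∘F]₀`. -/
def IsEMSolution (br : V4 → V4 → V4) (g F : V4 → V4 → ℝ) : Prop :=
  IsClosedForm br F ∧ IsCoclosed br g F ∧ ∀ x y, ricci0 br g x y = - FF0 g F x y

/-- Nijenhuis tensor `N_J(x,y) = [Jx,Jy] − J[Jx,y] − J[x,Jy] − [x,y]`. -/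
def nijenhuis (br : V4 → V4 → V4) (J : V4 →ₗ[ℝ] V4) (x y : V4) : V4 :=
  br (J x) (J y) - J (br (J x) y) - J (br x (J y)) - br x y

/-- The Lie algebra `𝒜₄,₄`: `[e₁,e₄] = e₁`, `[e₂,e₄] = e₁ + e₂`, `[e₃,e₄] = e₂ + e₃`. -/
def brA44 : V4 → V4 → V4 := fun x y =>
  ((x 0 * y 3 - x 3 * y 0) + (x 1 * y 3 - x 3 * y 1)) • ee 0
    + ((x 1 * y 3 - x 3 * y 1) + (x 2 * y 3 - x 3 * y 2)) • ee 1
    + (x 2 * y 3 - x 3 * y 2) • ee 2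

theorem eq_sum_smul_ee (x : V4) :
    x = x 0 • ee 0 + x 1 • ee 1 + x 2 • ee 2 + x 3 • ee 3 := by
  ext i
  fin_cases i <;> simp [ee]

theorem IsAltForm.add_right {F : V4 → V4 → ℝ} (hF : IsAltForm F) (x y z : V4) :
    F x (y + z) = F x y + F x z := by
  rw [hF.skew, hF.add_left, hF.skew y, hF.skew z]; ring

theorem IsAltForm.smul_right {F : V4 → V4 → ℝ} (hF : IsAltForm F) (a : ℝ) (x y : V4) :
    F x (a • y) = a * F x y := by
  rw [hF.skew, hF.smul_left, hF.skew y]; ring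

theorem IsAltForm.zero_left {F : V4 → V4 → ℝ} (hF : IsAltForm F) (x : V4) : F 0 x = 0 := by
  simpa using hF.smul_left 0 0 x

theorem IsAltForm.self_eq_zero {F : V4 → V4 → ℝ} (hF : IsAltForm F) (x : V4) : F x x = 0 := by
  linarith [hF.skew x x]

theorem IsInnerProduct.add_right {g : V4 → V4 → ℝ} (hg : IsInnerProduct g) (x y z : V4) :
    g x (y + z) = g x y + g x z := by
  rw [hg.symm, hg.add_left, hg.symm y, hg.symm z]

theorem IsInnerProduct.smul_right {g : V4 → V4 → ℝ} (hg : IsInnerProduct g) (a : ℝ) (x y : V4) :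
    g x (a • y) = a * g x y := by
  rw [hg.symm, hg.smul_left, hg.symm y]

theorem IsInnerProduct.zero_left {g : V4 → V4 → ℝ} (hg : IsInnerProduct g) (x : V4) :
    g 0 x = 0 := by
  simpa using hg.smul_left 0 0 x

theorem IsInnerProduct.posDef_gram {g : V4 → V4 → ℝ} (hg : IsInnerProduct g) :
    (gram g).PosDef := by
  refine Matrix.PosDef.of_dotProduct_mulVec_pos ?_ fun x hx => ?_
  · ext i j
    simp [gram, hg.symm (ee i) (ee j)]
  · have h := hg.pos x hx
    rw [eq_sum_smul_ee x] at h
    simp only [hg.add_left, hg.smul_left, hg.add_right, hg.smul_right] at h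
    simp only [dotProduct, Matrix.mulVec, gram, Matrix.of_apply, Fin.sum_univ_four, star_trivial]
    linarith

theorem IsInnerProduct.posDef_ginv {g : V4 → V4 → ℝ} (hg : IsInnerProduct g) :
    (ginv g).PosDef :=
  hg.posDef_gram.inv

theorem vol_ee_ne_zero {g : V4 → V4 → ℝ} (hg : IsInnerProduct g) :
    vol g (ee 0) (ee 1) (ee 2) (ee 3) ≠ 0 := by
  have h1 : (Matrix.of fun i j => ![ee 0, ee 1, ee 2, ee 3] i j) =
      (1 : Matrix (Fin 4) (Fin 4) ℝ) := by
    ext i j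
    fin_cases i <;> fin_cases j <;> simp [ee]
  rw [vol, h1, Matrix.det_one, mul_one]
  exact (Real.sqrt_pos.2 hg.posDef_gram.det_pos).ne'

/-- The derivation `ad e₄` has only positive eigenvalues on 2-forms of the ideal
`⟨e₁, e₂, e₃⟩`, so a closed 2-form vanishes on that ideal. -/
theorem IsClosedForm.brA44_restrict {F : V4 → V4 → ℝ} (hF : IsAltForm F)
    (h : IsClosedForm brA44 F) :
    F (ee 0) (ee 1) = 0 ∧ F (ee 0) (ee 2) = 0 ∧ F (ee 1) (ee 2) = 0 := by
  have h01 := h (ee 0) (ee 1) (ee 3)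
  have h02 := h (ee 0) (ee 2) (ee 3)
  have h12 := h (ee 1) (ee 2) (ee 3)
  have s10 := hF.skew (ee 1) (ee 0)
  have s20 := hF.skew (ee 2) (ee 0)
  have s21 := hF.skew (ee 2) (ee 1)
  have e : ∀ i j : Fin 4, ee i j = if j = i then 1 else 0 := fun i j => by
    simp [ee, Pi.single_apply]
  simp [cdiff, brA44, hF.add_left, hF.zero_left, hF.self_eq_zero, e] at h01 h02 h12
  refine ⟨?_, ?_, ?_⟩ <;> linarith

/-- A 2-form `f ∧ e⁴` of zero norm vanishes, by strict Cauchy–Schwarz. -/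
theorem eq_zero_of_formInner_self_eq_zero {g F : V4 → V4 → ℝ} (hg : IsInnerProduct g)
    (hF : IsAltForm F)
    (h : F (ee 0) (ee 1) = 0 ∧ F (ee 0) (ee 2) = 0 ∧ F (ee 1) (ee 2) = 0)
    (h0 : formInner g F F = 0) : F (ee 0) (ee 3) = 0 ∧ F (ee 1) (ee 3) = 0 ∧
      F (ee 2) (ee 3) = 0 := by
  obtain ⟨h01, h02, h12⟩ := h
  have hpos := hg.posDef_ginv
  have hsymm : ∀ i j, ginv g i j = ginv g j i := fun i j => by
    simpa using (hpos.1.apply j i)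
  have h33 : 0 < ginv g 3 3 := hpos.diag_pos
  set f : Fin 4 → ℝ := fun i => F (ee i) (ee 3) with hf
  set t : ℝ := ginv g 3 0 * f 0 + ginv g 3 1 * f 1 + ginv g 3 2 * f 2 with ht
  have hv : (![ginv g 3 3 * f 0, ginv g 3 3 * f 1, ginv g 3 3 * f 2, -t] : Fin 4 → ℝ) = 0 := by
    by_contra hne
    refine (hpos.dotProduct_mulVec_pos hne).ne' ?_
    rw [← mul_zero (ginv g 3 3), ← h0]
    simp only [formInner, dotProduct, Matrix.mulVec, Fin.sum_univ_four, star_trivial,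
      hF.self_eq_zero, hF.skew (ee 1) (ee 0), hF.skew (ee 2) (ee 0), hF.skew (ee 2) (ee 1),
      hF.skew (ee 3) (ee 0), hF.skew (ee 3) (ee 1), hF.skew (ee 3) (ee 2), h01, h02, h12,
      hsymm 1 0, hsymm 2 0, hsymm 2 1, hsymm 3 0, hsymm 3 1, hsymm 3 2, ht, hf,
      Matrix.cons_val]
    ring
  have key : ∀ x : ℝ, ginv g 3 3 * x = 0 → x = 0 := fun x hx =>
    (mul_eq_zero.1 hx).resolve_left h33.ne'
  exact ⟨key _ (congrFun hv 0), key _ (congrFun hv 1), key _ (congrFun hv 2)⟩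

theorem IsAltForm.eq_zero {F : V4 → V4 → ℝ} (hF : IsAltForm F)
    (h : F (ee 0) (ee 1) = 0 ∧ F (ee 0) (ee 2) = 0 ∧ F (ee 1) (ee 2) = 0)
    (h' : F (ee 0) (ee 3) = 0 ∧ F (ee 1) (ee 3) = 0 ∧ F (ee 2) (ee 3) = 0) (x y : V4) :
    F x y = 0 := by
  obtain ⟨h01, h02, h12⟩ := h
  obtain ⟨h03, h13, h23⟩ := h'
  rw [eq_sum_smul_ee x, eq_sum_smul_ee y]
  simp only [hF.add_left, hF.smul_left, hF.add_right, hF.smul_right, hF.self_eq_zero,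
    hF.skew (ee 1) (ee 0), hF.skew (ee 2) (ee 0), hF.skew (ee 2) (ee 1), hF.skew (ee 3) (ee 0),
    hF.skew (ee 3) (ee 1), hF.skew (ee 3) (ee 2), h01, h02, h12, h03, h13, h23]
  ring

/-- Closed and co-closed 2-forms on `𝒜₄,₄` vanish. -/
theorem eq_zero_of_isClosedForm_of_isCoclosed {g F : V4 → V4 → ℝ} (hg : IsInnerProduct g)
    (hF : IsAltForm F) (hc : IsClosedForm brA44 F) (hcc : IsCoclosed brA44 g F) (x y : V4) :
    F x y = 0 := by
  obtain ⟨sF, ⟨hsF, hstar⟩, hsc⟩ := hcc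
  have hr := hc.brA44_restrict hF
  obtain ⟨s01, s02, s12⟩ := hsc.brA44_restrict hsF
  have hw := hstar F hF (ee 0) (ee 1) (ee 2) (ee 3)
  simp only [wedge22, s01, s02, s12, hr.1, hr.2.1, hr.2.2, mul_zero, zero_mul, add_zero,
    sub_zero] at hw
  exact hF.eq_zero hr (eq_zero_of_formInner_self_eq_zero hg hF hr
    ((mul_eq_zero.1 hw.symm).resolve_right (vol_ee_ne_zero hg))) x y

/-- `𝒜₄,₄` admits no left-invariant non-Einstein solution to the Einstein--Maxwell equations. -/
theorem stmt10 :
    ∀ g F : V4 → V4 → ℝ, IsInnerProduct g → IsAltForm F →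
      IsEMSolution (brA44) g F → IsEinstein (brA44) g := by
  intro g F hg hF ⟨hc, hcc, hric⟩ x y
  have h := eq_zero_of_isClosedForm_of_isCoclosed hg hF hc hcc
  have hz : ∀ v, fhat g F v = 0 := fun v => by
    ext m
    simp [fhat, h]
  rw [hric, FF0]
  simp [hz, hg.zero_left]
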